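/- Suppose ℛ = {0, 1} (binary RSV) and: (Randomization) under P(·|S = e), D is independent of the pair (Y(0), Y(1)); (Positivity) P(S = e, D = d, Y = y) > 0, P(S = o, Y = y) > 0 and P(Y = y) > 0 for all d, y ∈ {0, 1}; (Stability) R is conditionally independent of S given (D, Y); (No direct effect) R is conditionally independent of D given Y. Let β := E[R | Y = 1] − E[R | Y = 0] and θ := E[Y(1) − Y(0) | S = e]. If β ≠ 0, then θ = (E[R | D = 1, S = e] − E[R | D = 0, S = e]) / β. -/

import Mathlib

open MeasureTheory ProbabilityTheory

noncomputable section

/-- Sample indicator values: experimental (`e`) or observational (`o`). -/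
inductive Sample : Type
  | e
  | o
deriving DecidableEq

instance : MeasurableSpace Sample := ⊤

/-- Real-valued indicator of a boolean (`{0,1}`-valued variable). -/
def b2r (b : Bool) : ℝ := if b then 1 else 0

/-- `CondIndepOf P R V W` : the conditional law of `R` given `V = v, W = w` agrees with
the conditional law of `R` given `V = v`, for all values with positive probability;
this is the notion of "R is conditionally independent of W given V" for variables with
countable ranges. -/
def CondIndepOf {Ω 𝓡 V W : Type*} [MeasurableSpace Ω] [MeasurableSpace 𝓡]
    (P : Measure Ω) (R : Ω → 𝓡) (Vf : Ω → V) (Wf : Ω → W) : Prop :=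
  ∀ v w, 0 < P {ω | Vf ω = v ∧ Wf ω = w} →
    (P[|{ω | Vf ω = v ∧ Wf ω = w}]).map R = (P[|{ω | Vf ω = v}]).map R

/-- The expectation of a `{0,1}`-valued variable is the probability that it equals one. -/
theorem integral_b2r {Ω : Type*} [MeasurableSpace Ω] (μ : Measure Ω) [IsFiniteMeasure μ]
    {X : Ω → Bool} (hX : Measurable X) :
    ∫ ω, b2r (X ω) ∂μ = μ.real {ω | X ω = true} := by
  have hm : MeasurableSet {ω | X ω = true} := hX (measurableSet_singleton true)
  rw [← integral_indicator_one hm]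
  refine integral_congr_ae (Filter.Eventually.of_forall fun ω => ?_)
  cases h : X ω <;> simp [b2r, h]

theorem integrable_b2r {Ω : Type*} [MeasurableSpace Ω] (μ : Measure Ω) [IsFiniteMeasure μ]
    {X : Ω → Bool} (hX : Measurable X) : Integrable (fun ω => b2r (X ω)) μ := by
  refine Integrable.of_bound ((measurable_of_countable b2r).comp hX).aestronglyMeasurable 1
    (Filter.Eventually.of_forall fun ω => ?_)
  cases h : X ω <;> simp [b2r]

theorem cond_real_apply {Ω : Type*} [MeasurableSpace Ω] {s : Set Ω} (hs : MeasurableSet s)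
    (μ : Measure Ω) (t : Set Ω) : (μ[|s]).real t = (μ.real s)⁻¹ * μ.real (s ∩ t) := by
  simp [measureReal_def, cond_apply hs]

/-- A set splits according to the value of a boolean variable. -/
theorem measureReal_eq_add_bool {Ω : Type*} [MeasurableSpace Ω] (μ : Measure Ω)
    [IsFiniteMeasure μ] {Y : Ω → Bool} (hY : Measurable Y) (A : Set Ω) :
    μ.real A = μ.real (A ∩ {ω | Y ω = true}) + μ.real (A ∩ {ω | Y ω = false}) := by
  have hm : MeasurableSet {ω | Y ω = true} := hY (measurableSet_singleton true)
  rw [← measureReal_inter_add_sdiff (s := A) hm]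
  congr 2
  ext ω
  simp

/-- Under stability and no direct effect, the law of `R` given `S = s`, `D = d`, `Y = y`
depends on `y` only. -/
theorem cond_map_eq_of_stability_of_noDirectEffect {Ω : Type*} [MeasurableSpace Ω]
    {P : Measure Ω} {S : Ω → Sample} {D Y R : Ω → Bool}
    (stability : CondIndepOf P R (fun ω => (D ω, Y ω)) S)
    (noDirectEffect : CondIndepOf P R Y D) {s : Sample} {d y : Bool}
    (hpos : 0 < P {ω | S ω = s ∧ D ω = d ∧ Y ω = y}) :
    (P[|{ω | S ω = s ∧ D ω = d ∧ Y ω = y}]).map R = (P[|{ω | Y ω = y}]).map R := by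
  have h₁ : {ω | (D ω, Y ω) = (d, y) ∧ S ω = s} = {ω | S ω = s ∧ D ω = d ∧ Y ω = y} := by
    ext ω
    simp only [Prod.mk.injEq, Set.mem_ofPred_eq]
    tauto
  have h₂ : {ω | (D ω, Y ω) = (d, y)} = {ω | Y ω = y ∧ D ω = d} := by
    ext ω
    simp only [Prod.mk.injEq, Set.mem_ofPred_eq]
    tauto
  have hpos' : 0 < P {ω | Y ω = y ∧ D ω = d} :=
    hpos.trans_le (measure_mono fun ω h => ⟨h.2.2, h.2.1⟩)
  have hst := stability (d, y) s (by rwa [h₁])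
  rw [h₁, h₂] at hst
  exact hst.trans (noDirectEffect y d hpos')

/-- In the experimental sample, the mean of `R` in the treatment arm `d` is affine in the mean
of the potential outcome `Z` of that arm. -/
theorem integral_b2r_cond_arm {Ω : Type*} [MeasurableSpace Ω]
    {P : Measure Ω} [IsProbabilityMeasure P] {S : Ω → Sample} {D Y R Z : Ω → Bool}
    (hS : Measurable S) (hD : Measurable D) (hY : Measurable Y) (hR : Measurable R)
    (hZ : Measurable Z) {d : Bool} (hYZ : ∀ ω, D ω = d → Y ω = Z ω)
    (hindep : IndepFun D Z (P[|{ω | S ω = Sample.e}]))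
    (hpos : ∀ y : Bool, 0 < P {ω | S ω = Sample.e ∧ D ω = d ∧ Y ω = y})
    (stability : CondIndepOf P R (fun ω => (D ω, Y ω)) S)
    (noDirectEffect : CondIndepOf P R Y D) :
    ∫ ω, b2r (R ω) ∂(P[|{ω | D ω = d ∧ S ω = Sample.e}]) =
      (∫ ω, b2r (R ω) ∂(P[|{ω | Y ω = false}])) +
        ((∫ ω, b2r (R ω) ∂(P[|{ω | Y ω = true}])) -
          (∫ ω, b2r (R ω) ∂(P[|{ω | Y ω = false}]))) *
        ∫ ω, b2r (Z ω) ∂(P[|{ω | S ω = Sample.e}]) := by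
  have mS : MeasurableSet {ω | S ω = Sample.e} := hS (t := {Sample.e}) trivial
  have mD : MeasurableSet {ω | D ω = d} := hD (measurableSet_singleton d)
  have mY (y : Bool) : MeasurableSet {ω | Y ω = y} := hY (measurableSet_singleton y)
  have mDS : MeasurableSet {ω | D ω = d ∧ S ω = Sample.e} := mD.inter mS
  have cell (y : Bool) :
      P.real ({ω | D ω = d ∧ S ω = Sample.e} ∩ {ω | R ω = true} ∩ {ω | Y ω = y}) =
        P.real ({ω | D ω = d ∧ S ω = Sample.e} ∩ {ω | Y ω = y}) *
          (P[|{ω | Y ω = y}]).real {ω | R ω = true} := by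
    have hlaw : (P[|{ω | S ω = Sample.e ∧ D ω = d ∧ Y ω = y}]).real {ω | R ω = true} =
        (P[|{ω | Y ω = y}]).real {ω | R ω = true} := by
      have h := congrArg (fun ν : Measure Bool => ν.real {true})
        (cond_map_eq_of_stability_of_noDirectEffect stability noDirectEffect (hpos y))
      simp only [map_measureReal_apply hR (measurableSet_singleton true)] at h
      exact h
    have hset : {ω | S ω = Sample.e ∧ D ω = d ∧ Y ω = y} =
        {ω | D ω = d ∧ S ω = Sample.e} ∩ {ω | Y ω = y} := by
      ext ω
      simp only [Set.mem_ofPred_eq, Set.mem_inter_iff]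
      tauto
    have hne : P.real ({ω | D ω = d ∧ S ω = Sample.e} ∩ {ω | Y ω = y}) ≠ 0 := by
      rw [← hset]
      exact (ENNReal.toReal_pos (hpos y).ne' (measure_ne_top _ _)).ne'
    rw [← hlaw, hset, cond_real_apply (mDS.inter (mY y)) P, mul_inv_cancel_left₀ hne,
      Set.inter_right_comm]
  have hDS_pos : 0 < P.real {ω | D ω = d ∧ S ω = Sample.e} := by
    have hle : P {ω | S ω = Sample.e ∧ D ω = d ∧ Y ω = true} ≤
        P {ω | D ω = d ∧ S ω = Sample.e} := measure_mono fun ω h => ⟨h.2.1, h.1⟩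
    exact ENNReal.toReal_pos ((hpos true).trans_le hle).ne' (measure_ne_top _ _)
  have hS_pos : 0 < P.real {ω | S ω = Sample.e} :=
    hDS_pos.trans_le (measureReal_mono (Set.inter_subset_right (s := {ω | D ω = d})))
  have harm : P.real ({ω | D ω = d ∧ S ω = Sample.e} ∩ {ω | Y ω = true}) =
      P.real {ω | D ω = d ∧ S ω = Sample.e} *
        (P[|{ω | S ω = Sample.e}]).real {ω | Z ω = true} := by
    have h := congrArg ENNReal.toReal (hindep.measure_inter_preimage_eq_mul {d} {true}
      (measurableSet_singleton d) (measurableSet_singleton true))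
    rw [ENNReal.toReal_mul] at h
    change (P[|{ω | S ω = Sample.e}]).real ({ω | D ω = d} ∩ {ω | Z ω = true}) =
      (P[|{ω | S ω = Sample.e}]).real {ω | D ω = d} *
        (P[|{ω | S ω = Sample.e}]).real {ω | Z ω = true} at h
    rw [cond_real_apply mS P, cond_real_apply mS P {ω | D ω = d}, mul_assoc] at h
    have h' := mul_left_cancel₀ (inv_ne_zero hS_pos.ne') h
    have hset₁ : {ω | D ω = d ∧ S ω = Sample.e} ∩ {ω | Y ω = true} =
        {ω | S ω = Sample.e} ∩ ({ω | D ω = d} ∩ {ω | Z ω = true}) := by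
      ext ω
      have := hYZ ω
      simp only [Set.mem_ofPred_eq, Set.mem_inter_iff]
      grind
    have hset₂ : {ω | D ω = d ∧ S ω = Sample.e} = {ω | S ω = Sample.e} ∩ {ω | D ω = d} :=
      Set.inter_comm _ _
    rw [hset₁, hset₂, h']
  have hsplit := measureReal_eq_add_bool P hY {ω | D ω = d ∧ S ω = Sample.e}
  simp only [integral_b2r _ hR, integral_b2r _ hZ]
  rw [cond_real_apply mDS P, measureReal_eq_add_bool P hY (_ ∩ _), cell, cell,
    inv_mul_eq_iff_eq_mul₀ hDS_pos.ne']
  linear_combination ((P[|{ω | Y ω = true}]).real {ω | R ω = true} -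
    (P[|{ω | Y ω = false}]).real {ω | R ω = true}) * harm -
      (P[|{ω | Y ω = false}]).real {ω | R ω = true} * hsplit

/-- **Proposition (Identification with binary variables):**
if `β ≠ 0` then `θ = (E[R|D=1,S=e] − E[R|D=0,S=e]) / β`. -/
theorem statement7
    {Ω : Type*} [MeasurableSpace Ω]
    (P : Measure Ω) [IsProbabilityMeasure P]
    (S : Ω → Sample) (D : Ω → Bool) (Y0 Y1 : Ω → Bool) (R : Ω → Bool)
    (hS : Measurable S) (hD : Measurable D) (hY0 : Measurable Y0) (hY1 : Measurable Y1)
    (hR : Measurable R)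
    (Y : Ω → Bool) (hYdef : ∀ ω, Y ω = if D ω then Y1 ω else Y0 ω)
    -- Randomization: D ⫫ (Y(0), Y(1)) under P(·|S = e)
    (randomization :
      IndepFun D (fun ω => (Y0 ω, Y1 ω)) (P[|{ω | S ω = Sample.e}]))
    -- Positivity
    (positivity_e : ∀ d y : Bool,
      0 < P {ω | S ω = Sample.e ∧ D ω = d ∧ Y ω = y})
    (positivity_o : ∀ y : Bool, 0 < P {ω | S ω = Sample.o ∧ Y ω = y})
    (positivity_Y : ∀ y : Bool, 0 < P {ω | Y ω = y})
    -- Stability: R ⫫ S | (D, Y)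
    (stability : CondIndepOf P R (fun ω => (D ω, Y ω)) S)
    -- No direct effect: R ⫫ D | Y
    (noDirectEffect : CondIndepOf P R Y D)
    -- β := E[R | Y = 1] − E[R | Y = 0]
    (β : ℝ)
    (hβ : β = (∫ ω, b2r (R ω) ∂(P[|{ω | Y ω = true}])) -
      (∫ ω, b2r (R ω) ∂(P[|{ω | Y ω = false}])))
    -- θ := E[Y(1) − Y(0) | S = e]
    (θ : ℝ)
    (hθ : θ = ∫ ω, (b2r (Y1 ω) - b2r (Y0 ω)) ∂(P[|{ω | S ω = Sample.e}]))
    (hβne : β ≠ 0) :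
    θ = ((∫ ω, b2r (R ω) ∂(P[|{ω | D ω = true ∧ S ω = Sample.e}])) -
      (∫ ω, b2r (R ω) ∂(P[|{ω | D ω = false ∧ S ω = Sample.e}]))) / β := by
  have hY : Measurable Y := by
    rw [funext hYdef]
    exact Measurable.ite (hD (measurableSet_singleton true)) hY1 hY0
  have h₁ := integral_b2r_cond_arm hS hD hY hR hY1 (d := true)
    (fun ω h => by simp [hYdef, h]) (randomization.comp measurable_id measurable_snd)
    (positivity_e true) stability noDirectEffect
  have h₀ := integral_b2r_cond_arm hS hD hY hR hY0 (d := false)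
    (fun ω h => by simp [hYdef, h]) (randomization.comp measurable_id measurable_fst)
    (positivity_e false) stability noDirectEffect
  rw [eq_div_iff hβne, h₁, h₀, hθ,
    integral_sub (integrable_b2r _ hY1) (integrable_b2r _ hY0), ← hβ]
  ring
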